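/- Let m ≥ 1 and H ≥ 1 be integers, V ∈ ℝ^S, and let (μ,ν) be an H-step lookahead policy for V. Then ‖T_{μ,ν}^m(T^{H−1}V) − J*‖_∞ ≤ (α^{H−1} + (1+α^m)·(α^{H−1}/(1−α))·(1+α))·‖V − J*‖_∞. -/

import Mathlib

open Finset Filter Topology Matrix

noncomputable section

/-- The probability simplex over a finite subset `D` of actions: nonnegative
weights summing to one over `D` and vanishing outside `D`. -/
def simplex {A : Type*} [Fintype A] (D : Finset A) : Set (A → ℝ) :=
  {p | (∀ a, 0 ≤ p a) ∧ (∑ a ∈ D, p a = 1) ∧ ∀ a ∉ D, p a = 0}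

/-- A finite two-player zero-sum discounted Markov game. `S` is the state space,
`A` the maximizer's global action type, `B` the minimizer's global action type. -/
structure MarkovGame (S A B : Type*) [Fintype S] [Fintype A] [Fintype B] where
  U : S → Finset A
  W : S → Finset B
  U_nonempty : ∀ s, (U s).Nonempty
  W_nonempty : ∀ s, (W s).Nonempty
  P : S → A → B → S → ℝ
  P_nonneg : ∀ s u v s', 0 ≤ P s u v s'
  P_sum : ∀ s, ∀ u ∈ U s, ∀ v ∈ W s, ∑ s', P s u v s' = 1
  g : S → A → B → ℝ
  g_nonneg : ∀ s u v, 0 ≤ g s u v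
  g_le_one : ∀ s u v, g s u v ≤ 1
  α : ℝ
  α_pos : 0 < α
  α_lt_one : α < 1

namespace MarkovGame

variable {S A B : Type*} [Fintype S] [Fintype A] [Fintype B]

/-- The state-action value matrix `A_{V,s}(u,v) = g(s,u,v) + α Σ_{s'} P(s'|s,u,v) V(s')`. -/
def Aval (G : MarkovGame S A B) (V : S → ℝ) (s : S) (u : A) (v : B) : ℝ :=
  G.g s u v + G.α * ∑ s', G.P s u v s' * V s'

/-- A policy pair assigns to each state probability vectors over the available actions. -/
def IsPolicy (G : MarkovGame S A B) (μ : S → A → ℝ) (ν : S → B → ℝ) : Prop :=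
  ∀ s, μ s ∈ simplex (G.U s) ∧ ν s ∈ simplex (G.W s)

/-- The Bellman operator of a policy pair: `(T_{μ,ν}V)(s) = μ(s)ᵀ A_{V,s} ν(s)`. -/
def Tpol (G : MarkovGame S A B) (μ : S → A → ℝ) (ν : S → B → ℝ) (V : S → ℝ) : S → ℝ :=
  fun s => ∑ u ∈ G.U s, ∑ v ∈ G.W s, μ s u * ν s v * G.Aval V s u v

/-- The Bellman optimality operator:
`(TV)(s) = max_{p ∈ Δ(U(s))} min_{q ∈ Δ(V(s))} pᵀ A_{V,s} q`. -/
def T (G : MarkovGame S A B) (V : S → ℝ) : S → ℝ :=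
  fun s => sSup {x | ∃ p ∈ simplex (G.U s),
    x = sInf {y | ∃ q ∈ simplex (G.W s),
      y = ∑ u ∈ G.U s, ∑ v ∈ G.W s, p u * q v * G.Aval V s u v}}

/-- The transition matrix `P_{μ,ν}` of a policy pair. -/
def Ppol (G : MarkovGame S A B) (μ : S → A → ℝ) (ν : S → B → ℝ) : Matrix S S ℝ :=
  Matrix.of fun s s' => ∑ u ∈ G.U s, ∑ v ∈ G.W s, μ s u * ν s v * G.P s u v s'

/-- The expected one-step reward `g_{μ,ν}` of a policy pair. -/
def gpol (G : MarkovGame S A B) (μ : S → A → ℝ) (ν : S → B → ℝ) : S → ℝ :=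
  fun s => ∑ u ∈ G.U s, ∑ v ∈ G.W s, μ s u * ν s v * G.g s u v

/-- `(μ,ν)` is an `H`-step lookahead policy for `V` if it is a policy pair and
`T_{μ,ν}(T^{H-1}V) = T^H V`. -/
def IsLookahead (G : MarkovGame S A B) (H : ℕ) (μ : S → A → ℝ) (ν : S → B → ℝ)
    (V : S → ℝ) : Prop :=
  G.IsPolicy μ ν ∧ G.Tpol μ ν (G.T^[H - 1] V) = G.T^[H] V

end MarkovGame

/-- Lipschitz comparison of infima indexed by the points of a set. -/
lemma sInf_le_sInf_add_of_forall_le {X : Type*} {D : Set X} (hD : D.Nonempty) {f h : X → ℝ}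
    {b c : ℝ} (hb : ∀ x ∈ D, b ≤ f x) (hfh : ∀ x ∈ D, f x ≤ h x + c) :
    sInf {y | ∃ x ∈ D, y = f x} ≤ sInf {y | ∃ x ∈ D, y = h x} + c := by
  rw [← sub_le_iff_le_add]
  refine le_csInf ?_ ?_
  · obtain ⟨x, hx⟩ := hD
    exact ⟨h x, x, hx, rfl⟩
  · rintro _ ⟨x, hx, rfl⟩
    have hle : sInf {y | ∃ x ∈ D, y = f x} ≤ f x := by
      refine csInf_le ⟨b, ?_⟩ ⟨x, hx, rfl⟩
      rintro _ ⟨z, hz, rfl⟩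
      exact hb z hz
    linarith [hfh x hx]

/-- Lipschitz comparison of suprema indexed by the points of a set. -/
lemma sSup_le_sSup_add_of_forall_le {X : Type*} {D : Set X} (hD : D.Nonempty) {f h : X → ℝ}
    {b c : ℝ} (hb : ∀ x ∈ D, h x ≤ b) (hfh : ∀ x ∈ D, f x ≤ h x + c) :
    sSup {y | ∃ x ∈ D, y = f x} ≤ sSup {y | ∃ x ∈ D, y = h x} + c := by
  refine csSup_le ?_ ?_
  · obtain ⟨x, hx⟩ := hD
    exact ⟨f x, x, hx, rfl⟩
  · rintro _ ⟨x, hx, rfl⟩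
    have hle : h x ≤ sSup {y | ∃ x ∈ D, y = h x} := by
      refine le_csSup ⟨b, ?_⟩ ⟨x, hx, rfl⟩
      rintro _ ⟨z, hz, rfl⟩
      exact hb z hz
    linarith [hfh x hx]

lemma simplex_nonempty {A : Type*} [Fintype A] {D : Finset A} (hD : D.Nonempty) :
    (simplex D).Nonempty := by
  classical
  obtain ⟨a, ha⟩ := hD
  refine ⟨Pi.single a 1, fun b => ?_, ?_, fun b hb => ?_⟩
  · by_cases h : b = a
    · subst h; simp
    · simp [h]
  · simp [Pi.single_apply, ha]
  · have hba : b ≠ a := by rintro rfl; exact hb ha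
    simp [hba]

/-- A bilinear average of values bounded by `c` is bounded by `c`. -/
lemma abs_sum_simplex_le {A B : Type*} [Fintype A] [Fintype B] {D : Finset A} {E : Finset B}
    {p : A → ℝ} {q : B → ℝ} (hp : p ∈ simplex D) (hq : q ∈ simplex E) {a : A → B → ℝ} {c : ℝ}
    (ha : ∀ u ∈ D, ∀ v ∈ E, |a u v| ≤ c) :
    |∑ u ∈ D, ∑ v ∈ E, p u * q v * a u v| ≤ c := by
  calc |∑ u ∈ D, ∑ v ∈ E, p u * q v * a u v|
      ≤ ∑ u ∈ D, ∑ v ∈ E, |p u * q v * a u v| :=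
        (Finset.abs_sum_le_sum_abs _ _).trans
          (Finset.sum_le_sum fun u _ => Finset.abs_sum_le_sum_abs _ _)
    _ ≤ ∑ u ∈ D, ∑ v ∈ E, p u * q v * c := by
        refine Finset.sum_le_sum fun u hu => Finset.sum_le_sum fun v hv => ?_
        have hpq : 0 ≤ p u * q v := mul_nonneg (hp.1 u) (hq.1 v)
        rw [abs_mul, abs_of_nonneg hpq]
        exact mul_le_mul_of_nonneg_left (ha u hu v hv) hpq
    _ = c := by
        simp_rw [← Finset.sum_mul, ← Finset.mul_sum, hq.2.1, mul_one, hp.2.1, one_mul]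

/-- Iterates of a contraction move a point at most `1 / (1 - c)` times its first step. -/
lemma norm_iterate_sub_self_le {E : Type*} [NormedAddCommGroup E] {F : E → E} {c : ℝ}
    (hc : 0 ≤ c) (hc1 : c < 1) (hF : ∀ x y, ‖F x - F y‖ ≤ c * ‖x - y‖) (x : E) (n : ℕ) :
    ‖F^[n] x - x‖ ≤ ‖F x - x‖ / (1 - c) := by
  have h1 : 0 < 1 - c := sub_pos.2 hc1
  induction n with
  | zero => simpa using div_nonneg (norm_nonneg _) h1.le
  | succ n ih =>
    rw [Function.iterate_succ_apply']
    calc ‖F (F^[n] x) - x‖ ≤ ‖F (F^[n] x) - F x‖ + ‖F x - x‖ :=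
          norm_sub_le_norm_sub_add_norm_sub _ _ _
      _ ≤ c * (‖F x - x‖ / (1 - c)) + ‖F x - x‖ := by
          gcongr
          exact (hF _ _).trans (mul_le_mul_of_nonneg_left ih hc)
      _ = ‖F x - x‖ / (1 - c) := by field_simp; ring

namespace MarkovGame

variable {S A B : Type*} [Fintype S] [Fintype A] [Fintype B]

lemma abs_Aval_sub_le (G : MarkovGame S A B) (V V' : S → ℝ) {s : S} {u : A} {v : B}
    (hu : u ∈ G.U s) (hv : v ∈ G.W s) :
    |G.Aval V s u v - G.Aval V' s u v| ≤ G.α * ‖V - V'‖ := by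
  have hsum : |∑ s', G.P s u v s' * (V - V') s'| ≤ ‖V - V'‖ := by
    calc |∑ s', G.P s u v s' * (V - V') s'|
        ≤ ∑ s', |G.P s u v s' * (V - V') s'| := Finset.abs_sum_le_sum_abs _ _
      _ ≤ ∑ s', G.P s u v s' * ‖V - V'‖ := by
          refine Finset.sum_le_sum fun s' _ => ?_
          rw [abs_mul, abs_of_nonneg (G.P_nonneg s u v s')]
          exact mul_le_mul_of_nonneg_left (norm_le_pi_norm (V - V') s') (G.P_nonneg s u v s')
      _ = ‖V - V'‖ := by rw [← Finset.sum_mul, G.P_sum s u hu v hv, one_mul]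
  have heq : G.Aval V s u v - G.Aval V' s u v = G.α * ∑ s', G.P s u v s' * (V - V') s' := by
    simp only [Aval, Pi.sub_apply, mul_sub, Finset.sum_sub_distrib]
    ring
  rw [heq, abs_mul, abs_of_pos G.α_pos]
  exact mul_le_mul_of_nonneg_left hsum G.α_pos.le

lemma abs_Aval_le (G : MarkovGame S A B) (V : S → ℝ) {s : S} {u : A} {v : B}
    (hu : u ∈ G.U s) (hv : v ∈ G.W s) : |G.Aval V s u v| ≤ 1 + G.α * ‖V‖ := by
  have h := G.abs_Aval_sub_le V 0 hu hv
  have h0 : G.Aval 0 s u v = G.g s u v := by simp [Aval]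
  rw [h0, sub_zero, abs_le] at h
  rw [abs_le]
  constructor <;> linarith [h.1, h.2, G.g_nonneg s u v, G.g_le_one s u v]

lemma abs_sum_Aval_sub_le (G : MarkovGame S A B) (V V' : S → ℝ) {s : S} {p : A → ℝ} {q : B → ℝ}
    (hp : p ∈ simplex (G.U s)) (hq : q ∈ simplex (G.W s)) :
    |∑ u ∈ G.U s, ∑ v ∈ G.W s, p u * q v * G.Aval V s u v -
      ∑ u ∈ G.U s, ∑ v ∈ G.W s, p u * q v * G.Aval V' s u v| ≤ G.α * ‖V - V'‖ := by
  simp_rw [← Finset.sum_sub_distrib, ← mul_sub]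
  exact abs_sum_simplex_le hp hq fun u hu v hv => G.abs_Aval_sub_le V V' hu hv

lemma norm_Tpol_sub_le (G : MarkovGame S A B) {μ : S → A → ℝ} {ν : S → B → ℝ}
    (h : G.IsPolicy μ ν) (V V' : S → ℝ) :
    ‖G.Tpol μ ν V - G.Tpol μ ν V'‖ ≤ G.α * ‖V - V'‖ :=
  (pi_norm_le_iff_of_nonneg (mul_nonneg G.α_pos.le (norm_nonneg _))).2 fun s =>
    G.abs_sum_Aval_sub_le V V' (h s).1 (h s).2

lemma T_le_T_add (G : MarkovGame S A B) (V V' : S → ℝ) (s : S) :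
    G.T V s ≤ G.T V' s + G.α * ‖V - V'‖ := by
  have hbound (V : S → ℝ) {p : A → ℝ} {q : B → ℝ} (hp : p ∈ simplex (G.U s))
      (hq : q ∈ simplex (G.W s)) :=
    abs_le.1 (abs_sum_simplex_le hp hq fun u hu v hv => G.abs_Aval_le V hu hv)
  have hW := simplex_nonempty (G.W_nonempty s)
  refine sSup_le_sSup_add_of_forall_le (simplex_nonempty (G.U_nonempty s))
    (b := 1 + G.α * ‖V'‖) (fun p hp => ?_) fun p hp => ?_
  · obtain ⟨q, hq⟩ := hW
    refine le_trans (csInf_le ?_ ⟨q, hq, rfl⟩) (hbound V' hp hq).2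
    refine ⟨-(1 + G.α * ‖V'‖), ?_⟩
    rintro _ ⟨q', hq', rfl⟩
    exact (hbound V' hp hq').1
  · refine sInf_le_sInf_add_of_forall_le hW (fun q hq => (hbound V hp hq).1) fun q hq => ?_
    linarith [(abs_le.1 (G.abs_sum_Aval_sub_le V V' hp hq)).2]

/-- The Bellman optimality operator is an `α`-contraction in the supremum norm. -/
lemma norm_T_sub_le (G : MarkovGame S A B) (V V' : S → ℝ) :
    ‖G.T V - G.T V'‖ ≤ G.α * ‖V - V'‖ := by
  refine (pi_norm_le_iff_of_nonneg (mul_nonneg G.α_pos.le (norm_nonneg _))).2 fun s => ?_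
  rw [Pi.sub_apply, Real.norm_eq_abs, abs_sub_le_iff]
  have h := G.T_le_T_add V V' s
  have h' := G.T_le_T_add V' V s
  rw [norm_sub_rev] at h'
  constructor <;> linarith

lemma norm_iterate_T_sub_le (G : MarkovGame S A B) {J : S → ℝ} (hJ : G.T J = J) (V : S → ℝ)
    (n : ℕ) : ‖G.T^[n] V - J‖ ≤ G.α ^ n * ‖V - J‖ := by
  induction n with
  | zero => simp
  | succ n ih =>
    rw [Function.iterate_succ_apply', pow_succ', mul_assoc]
    calc ‖G.T (G.T^[n] V) - J‖ = ‖G.T (G.T^[n] V) - G.T J‖ := by rw [hJ]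
      _ ≤ G.α * ‖G.T^[n] V - J‖ := G.norm_T_sub_le _ _
      _ ≤ G.α * (G.α ^ n * ‖V - J‖) := mul_le_mul_of_nonneg_left ih G.α_pos.le

end MarkovGame

/-- If `(μ,ν)` is an `H`-step lookahead policy for `V`, then
`‖T_{μ,ν}^m(T^{H−1}V) − J*‖_∞ ≤ (α^{H−1} + (1+α^m)(α^{H−1}/(1−α))(1+α))·‖V − J*‖_∞`. -/
theorem stmt_10 {S A B : Type*} [Fintype S] [Fintype A] [Fintype B]
    (G : MarkovGame S A B) (m H : ℕ) (hm : 1 ≤ m) (hH : 1 ≤ H) (V : S → ℝ)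
    (μ : S → A → ℝ) (ν : S → B → ℝ) (hLA : G.IsLookahead H μ ν V)
    (Jstar : S → ℝ) (hJ : G.T Jstar = Jstar) :
    ‖(G.Tpol μ ν)^[m] (G.T^[H - 1] V) - Jstar‖ ≤
      (G.α ^ (H - 1) + (1 + G.α ^ m) * (G.α ^ (H - 1) / (1 - G.α)) * (1 + G.α)) *
        ‖V - Jstar‖ := by
  obtain ⟨hpol, hstep⟩ := hLA
  have h1 : 0 < 1 - G.α := sub_pos.2 G.α_lt_one
  set W := G.T^[H - 1] V with hWdef
  have hstep' : G.Tpol μ ν W = G.T W := by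
    rw [hstep, hWdef, ← Function.iterate_succ_apply' G.T, Nat.succ_eq_add_one, Nat.sub_add_cancel hH]
  have hW : ‖W - Jstar‖ ≤ G.α ^ (H - 1) * ‖V - Jstar‖ := G.norm_iterate_T_sub_le hJ V (H - 1)
  have hres : ‖G.Tpol μ ν W - W‖ ≤ (1 + G.α) * ‖W - Jstar‖ := by
    have hT := G.norm_T_sub_le W Jstar
    rw [hJ] at hT
    have htri := norm_sub_le_norm_sub_add_norm_sub (G.T W) Jstar W
    rw [norm_sub_rev Jstar W] at htri
    rw [hstep']
    linarith
  have hpow : 0 ≤ G.α ^ m := pow_nonneg G.α_pos.le m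
  have hpowH : 0 ≤ G.α ^ (H - 1) := pow_nonneg G.α_pos.le _
  have hα := G.α_pos
  calc ‖(G.Tpol μ ν)^[m] W - Jstar‖
      ≤ ‖(G.Tpol μ ν)^[m] W - W‖ + ‖W - Jstar‖ := norm_sub_le_norm_sub_add_norm_sub _ _ _
    _ ≤ (1 + G.α) * ‖W - Jstar‖ / (1 - G.α) + ‖W - Jstar‖ := by
        gcongr
        exact (norm_iterate_sub_self_le G.α_pos.le G.α_lt_one (G.norm_Tpol_sub_le hpol) W m).trans
          (by gcongr)
    _ ≤ (1 + G.α) * (G.α ^ (H - 1) * ‖V - Jstar‖) / (1 - G.α) +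
          G.α ^ (H - 1) * ‖V - Jstar‖ := by gcongr
    _ = (G.α ^ (H - 1) + 1 * (G.α ^ (H - 1) / (1 - G.α)) * (1 + G.α)) * ‖V - Jstar‖ := by ring
    _ ≤ (G.α ^ (H - 1) + (1 + G.α ^ m) * (G.α ^ (H - 1) / (1 - G.α)) * (1 + G.α)) *
          ‖V - Jstar‖ := by
        gcongr
        linarith
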